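/- arXiv:0805.1614 — 2 statements merged into one kernel-verified Lean document; each statement's English description precedes it below -/
import Mathlib

section
/- Let f_0,...,f_n ∈ C^n([a,b]) and assume that for each k = 0,...,n the linear span U_k of f_0,...,f_k is an extended Chebyshev space of dimension k+1 over [a,b]. Then, after possibly replacing f_0 by −f_0 and f_1 by −f_1 so that f_0 > 0 and f_1/f_0 is strictly increasing, for every k = 1,...,n there exists a Bernstein operator B_k : C[a,b] → U_k fixing f_0 and f_1 whose nodes are strictly increasing, and for k ≥ 2 the nodes of B_k strictly interlace with those of B_{k−1}. -/
open Finset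

def IsBernsteinBasisOf (n : ℕ) (a b : ℝ) (U : Submodule ℝ (ℝ → ℝ)) (p : ℕ → ℝ → ℝ) : Prop :=
  (∀ k ≤ n, p k ∈ U) ∧
  (∀ k ≤ n, ContDiff ℝ n (p k)) ∧
  (∀ k ≤ n,
    (∀ i < k, iteratedDeriv i (p k) a = 0) ∧ iteratedDeriv k (p k) a ≠ 0 ∧
    (∀ i < n - k, iteratedDeriv i (p k) b = 0) ∧ iteratedDeriv (n - k) (p k) b ≠ 0)

def IsNonnegBernsteinBasisOf (n : ℕ) (a b : ℝ) (U : Submodule ℝ (ℝ → ℝ)) (p : ℕ → ℝ → ℝ) : Prop :=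
  IsBernsteinBasisOf n a b U p ∧ ∀ k ≤ n, ∀ x ∈ Set.Icc a b, 0 ≤ p k x

def IsHaarPair (a b : ℝ) (f0 f1 : ℝ → ℝ) : Prop :=
  ContinuousOn f0 (Set.Icc a b) ∧ ContinuousOn f1 (Set.Icc a b) ∧
  (∀ x ∈ Set.Icc a b, 0 < f0 x) ∧
  StrictMonoOn (fun x => f1 x / f0 x) (Set.Icc a b)

noncomputable def bernOp (n : ℕ) (p : ℕ → ℝ → ℝ) (t : ℕ → ℝ) (α : ℕ → ℝ) (f : ℝ → ℝ) : ℝ → ℝ :=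
  fun x => ∑ k ∈ Finset.range (n + 1), f (t k) * α k * p k x

def FixesOn (a b : ℝ) (B : (ℝ → ℝ) → ℝ → ℝ) (f : ℝ → ℝ) : Prop :=
  ∀ x ∈ Set.Icc a b, B f x = f x

def ConvexWrt (a b : ℝ) (f0 f1 f : ℝ → ℝ) : Prop :=
  ∀ x0 ∈ Set.Icc a b, ∀ x1 ∈ Set.Icc a b, ∀ x2 ∈ Set.Icc a b, x0 < x1 → x1 < x2 →
    0 ≤ Matrix.det !![f0 x0, f0 x1, f0 x2; f1 x0, f1 x1, f1 x2; f x0, f x1, f x2]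

def IsExtChebyshev (m : ℕ) (a b : ℝ) (U : Submodule ℝ (ℝ → ℝ)) : Prop :=
  Module.finrank ℝ U = m + 1 ∧
  (∀ f ∈ U, ContDiff ℝ m f) ∧
  (∀ f ∈ U, f ≠ 0 → ∀ (S : Finset ℝ) (μ : ℝ → ℕ),
    (∀ x ∈ S, x ∈ Set.Icc a b) →
    (∀ x ∈ S, ∀ i < μ x, iteratedDeriv i f x = 0) →
    ∑ x ∈ S, μ x ≤ m)

open Filter Topology in
/-- A function whose first nonvanishing derivative at `a` is positive is positive just to the right
of `a`. -/
lemma eventually_pos_of_iteratedDeriv_pos (m : ℕ) :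
    ∀ (g : ℝ → ℝ) (a : ℝ), ContDiff ℝ m g → (∀ i < m, iteratedDeriv i g a = 0) →
      0 < iteratedDeriv m g a → ∀ᶠ x in 𝓝[>] a, 0 < g x := by
  induction m with
  | zero =>
    intro g a hg _ hpos
    rw [iteratedDeriv_zero] at hpos
    exact ((hg.continuous.tendsto a).mono_left nhdsWithin_le_nhds).eventually_const_lt hpos
  | succ m ih =>
    intro g a hg hz hpos
    have hg' : ContDiff ℝ m (deriv g) := by
      rw [Nat.cast_succ, contDiff_succ_iff_deriv] at hg
      exact hg.2.2
    have hev := ih (deriv g) a hg'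
      (fun i hi => by rw [← iteratedDeriv_succ']; exact hz _ (by omega))
      (by rwa [← iteratedDeriv_succ'])
    obtain ⟨c, hc, hsub⟩ := mem_nhdsGT_iff_exists_Ioo_subset.1 hev
    have hga : g a = 0 := by simpa using hz 0 (by omega)
    filter_upwards [Ioo_mem_nhdsGT hc] with x hx
    have hmono : StrictMonoOn g (Set.Icc a x) := by
      apply strictMonoOn_of_deriv_pos (convex_Icc a x) hg.continuous.continuousOn
      intro y hy
      rw [interior_Icc] at hy
      exact hsub ⟨hy.1, hy.2.trans hx.2⟩
    have := hmono ⟨le_rfl, hx.1.le⟩ ⟨hx.1.le, le_rfl⟩ hx.1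
    rwa [hga] at this

open Filter Topology in
lemma iteratedDeriv_pos_of_nonneg {m : ℕ} {g : ℝ → ℝ} {a b : ℝ} (hab : a < b)
    (hg : ContDiff ℝ m g) (hz : ∀ i < m, iteratedDeriv i g a = 0)
    (hne : iteratedDeriv m g a ≠ 0) (hnn : ∀ x ∈ Set.Icc a b, 0 ≤ g x) :
    0 < iteratedDeriv m g a := by
  by_contra hle
  have hneg : 0 < iteratedDeriv m (-g) a := by
    rw [iteratedDeriv_neg]
    have := lt_of_le_of_ne (not_lt.1 hle) hne
    simpa using this
  have hev := eventually_pos_of_iteratedDeriv_pos m (-g) a hg.neg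
    (fun i hi => by rw [iteratedDeriv_neg]; simp [hz i hi]) hneg
  obtain ⟨x, hx, hx'⟩ := (hev.and (Ioo_mem_nhdsGT hab)).exists
  have := hnn x ⟨hx'.1.le, hx'.2.le⟩
  simp only [Pi.neg_apply] at hx
  linarith

lemma neg_one_pow_mul_iteratedDeriv_pos_of_nonneg {m : ℕ} {g : ℝ → ℝ} {a b : ℝ} (hab : a < b)
    (hg : ContDiff ℝ m g) (hz : ∀ i < m, iteratedDeriv i g b = 0)
    (hne : iteratedDeriv m g b ≠ 0) (hnn : ∀ x ∈ Set.Icc a b, 0 ≤ g x) :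
    0 < (-1 : ℝ) ^ m * iteratedDeriv m g b := by
  have key := iteratedDeriv_pos_of_nonneg (m := m) (g := fun x => g (-x)) (neg_lt_neg hab)
    (hg.comp contDiff_neg)
    (fun i hi => by rw [iteratedDeriv_comp_neg]; simp [hz i hi])
    (by rw [iteratedDeriv_comp_neg]; simpa using hne)
    (fun x hx => hnn _ ⟨by linarith [hx.2], by linarith [hx.1]⟩)
  rw [iteratedDeriv_comp_neg] at key
  simpa using key

/-- A continuous function without zeros inside an interval has a constant sign there. -/
lemma nonneg_or_nonpos_of_ne_zero {a b : ℝ} {g : ℝ → ℝ} (hg : Continuous g)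
    (h : ∀ z ∈ Set.Ioo a b, g z ≠ 0) :
    (∀ x ∈ Set.Icc a b, 0 ≤ g x) ∨ ∀ x ∈ Set.Icc a b, g x ≤ 0 := by
  by_contra! hcon
  obtain ⟨⟨x, hx, hgx⟩, y, hy, hgy⟩ := hcon
  obtain ⟨z, hz, hgz⟩ := intermediate_value_uIcc (hg.continuousOn (s := Set.uIcc x y))
    (Set.mem_uIcc.2 (Or.inl ⟨hgx.le, hgy.le⟩))
  have hzx : z ≠ x := by rintro rfl; linarith
  have hzy : z ≠ y := by rintro rfl; linarith
  refine h z ?_ hgz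
  rcases Set.mem_uIcc.1 hz with ⟨h1, h2⟩ | ⟨h1, h2⟩
  · exact ⟨hx.1.trans_lt (lt_of_le_of_ne h1 hzx.symm), (lt_of_le_of_ne h2 hzy).trans_le hy.2⟩
  · exact ⟨hy.1.trans_lt (lt_of_le_of_ne h1 hzy.symm), (lt_of_le_of_ne h2 hzx).trans_le hx.2⟩

namespace IsExtChebyshev

variable {m : ℕ} {a b : ℝ} {U : Submodule ℝ (ℝ → ℝ)}

lemma eq_zero_of_endpoint_zeros (hU : IsExtChebyshev m a b U) (hab : a < b) {g : ℝ → ℝ}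
    (hg : g ∈ U) {i j : ℕ} (hij : m < i + j) (ha : ∀ l < i, iteratedDeriv l g a = 0)
    (hb : ∀ l < j, iteratedDeriv l g b = 0) : g = 0 := by
  by_contra hne
  have := hU.2.2 g hg hne {a, b} (fun x => if x = a then i else j)
    (by simp [hab.le])
    (by simp only [mem_insert, mem_singleton]
        rintro x (rfl | rfl) l hl
        · exact ha l (by simpa using hl)
        · exact hb l (by simpa [hab.ne'] using hl))
  rw [sum_pair hab.ne] at this
  simp only [if_true, if_neg hab.ne'] at this
  omega

lemma ne_zero_of_endpoint_zeros (hU : IsExtChebyshev m a b U) {g : ℝ → ℝ}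
    (hg : g ∈ U) (hg0 : g ≠ 0) {i j : ℕ} (hij : m ≤ i + j) (ha : ∀ l < i, iteratedDeriv l g a = 0)
    (hb : ∀ l < j, iteratedDeriv l g b = 0) {z : ℝ} (hz : z ∈ Set.Ioo a b) : g z ≠ 0 := by
  intro h0
  have hza := hz.1.ne'
  have hzb := hz.2.ne
  have hba := (hz.1.trans hz.2).ne'
  have := hU.2.2 g hg hg0 {a, b, z} (fun x => if x = a then i else if x = b then j else 1)
    (by simp [(hz.1.trans hz.2).le, hz.1.le, hz.2.le])
    (by simp only [mem_insert, mem_singleton]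
        rintro x (rfl | rfl | rfl) l hl
        · exact ha l (by simpa using hl)
        · exact hb l (by simpa [hba] using hl)
        · obtain rfl : l = 0 := by simpa [hza, hzb] using hl
          simpa using h0)
  rw [sum_insert (by simp [hba.symm, hza.symm]), sum_pair hzb.symm] at this
  simp only [if_true, if_neg hba, if_neg hza, if_neg hzb] at this
  omega

lemma exists_endpoint_zeros (hU : IsExtChebyshev m a b U) {i j : ℕ} (hij : i + j ≤ m) :
    ∃ g ∈ U, g ≠ 0 ∧ (∀ l < i, iteratedDeriv l g a = 0) ∧ ∀ l < j, iteratedDeriv l g b = 0 := by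
  have hfin : Module.Finite ℝ U := Module.finite_of_finrank_pos (by rw [hU.1]; omega)
  have hsm : ∀ (u : U) (l : ℕ), l ≤ m → ∀ x, ContDiffAt ℝ l (u : ℝ → ℝ) x := fun u l hl x =>
    ((hU.2.1 u u.2).of_le (by exact_mod_cast hl)).contDiffAt
  let L : U →ₗ[ℝ] (Fin i ⊕ Fin j → ℝ) :=
    { toFun := fun u => Sum.elim (fun l => iteratedDeriv l (u : ℝ → ℝ) a)
        (fun l => iteratedDeriv l (u : ℝ → ℝ) b)
      map_add' := by
        intro u v
        ext (l | l)
        · exact iteratedDeriv_add (hsm u l (by omega) a) (hsm v l (by omega) a)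
        · exact iteratedDeriv_add (hsm u l (by omega) b) (hsm v l (by omega) b)
      map_smul' := by
        intro c u
        ext (l | l)
        · exact iteratedDeriv_const_smul (hsm u l (by omega) a) c
        · exact iteratedDeriv_const_smul (hsm u l (by omega) b) c }
  have hker : LinearMap.ker L ≠ ⊥ := LinearMap.ker_ne_bot_of_finrank_lt (by
    rw [hU.1, Module.finrank_fintype_fun_eq_card]
    simp only [Fintype.card_sum, Fintype.card_fin]
    omega)
  obtain ⟨u, hu, hu0⟩ := (Submodule.ne_bot_iff _).1 hker
  rw [LinearMap.mem_ker] at hu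
  refine ⟨u, u.2, by simpa using hu0, fun l hl => ?_, fun l hl => ?_⟩
  · exact congrFun hu (Sum.inl ⟨l, hl⟩)
  · exact congrFun hu (Sum.inr ⟨l, hl⟩)

lemma exists_nonnegBernsteinBasis (hU : IsExtChebyshev m a b U) (hab : a < b) :
    ∃ p, IsNonnegBernsteinBasisOf m a b U p := by
  have key : ∀ k ≤ m, ∃ g ∈ U, g ≠ 0 ∧ (∀ l < k, iteratedDeriv l g a = 0) ∧
      (∀ l < m - k, iteratedDeriv l g b = 0) ∧ ∀ x ∈ Set.Icc a b, 0 ≤ g x := by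
    intro k hk
    obtain ⟨g, hg, hg0, ha, hb⟩ := hU.exists_endpoint_zeros (i := k) (j := m - k) (by omega)
    rcases nonneg_or_nonpos_of_ne_zero (hU.2.1 g hg).continuous
      (fun z hz => hU.ne_zero_of_endpoint_zeros hg hg0 (by omega) ha hb hz) with h | h
    · exact ⟨g, hg, hg0, ha, hb, h⟩
    · refine ⟨-g, U.neg_mem hg, neg_ne_zero.2 hg0, fun l hl => ?_, fun l hl => ?_, fun x hx => ?_⟩
      · rw [iteratedDeriv_neg]; simp [ha l hl]
      · rw [iteratedDeriv_neg]; simp [hb l hl]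
      · simpa using h x hx
  choose! p hpU hp0 hpa hpb hpn using key
  refine ⟨p, ⟨hpU, fun k hk => hU.2.1 _ (hpU k hk), fun k hk => ⟨hpa k hk, fun h => ?_, hpb k hk,
    fun h => ?_⟩⟩, hpn⟩
  · refine hp0 k hk (hU.eq_zero_of_endpoint_zeros hab (hpU k hk) (i := k + 1) (j := m - k)
      (by omega) (fun l hl => ?_) (hpb k hk))
    rcases Nat.lt_succ_iff_lt_or_eq.1 hl with h' | rfl
    exacts [hpa k hk l h', h]
  · refine hp0 k hk (hU.eq_zero_of_endpoint_zeros hab (hpU k hk) (i := k) (j := m - k + 1)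
      (by omega) (hpa k hk) (fun l hl => ?_))
    rcases Nat.lt_succ_iff_lt_or_eq.1 hl with h' | rfl
    exacts [hpb k hk l h', h]

end IsExtChebyshev

namespace IsNonnegBernsteinBasisOf

variable {m : ℕ} {a b : ℝ} {U V : Submodule ℝ (ℝ → ℝ)} {p q : ℕ → ℝ → ℝ}

lemma iteratedDeriv_left_pos (hp : IsNonnegBernsteinBasisOf m a b U p) (hab : a < b) {k : ℕ}
    (hk : k ≤ m) : 0 < iteratedDeriv k (p k) a :=
  iteratedDeriv_pos_of_nonneg hab ((hp.1.2.1 k hk).of_le (by exact_mod_cast hk))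
    (hp.1.2.2 k hk).1 (hp.1.2.2 k hk).2.1 (hp.2 k hk)

lemma iteratedDeriv_right_pos (hp : IsNonnegBernsteinBasisOf m a b U p) (hab : a < b) {k : ℕ}
    (hk : k ≤ m) : 0 < (-1 : ℝ) ^ (m - k) * iteratedDeriv (m - k) (p k) b :=
  neg_one_pow_mul_iteratedDeriv_pos_of_nonneg hab
    ((hp.1.2.1 k hk).of_le (by exact_mod_cast Nat.sub_le m k))
    (hp.1.2.2 k hk).2.2.1 (hp.1.2.2 k hk).2.2.2 (hp.2 k hk)

/-- Degree elevation. -/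
lemma exists_elevation (hp : IsNonnegBernsteinBasisOf m a b U p)
    (hq : IsNonnegBernsteinBasisOf (m + 1) a b V q) (hV : IsExtChebyshev (m + 1) a b V)
    (hab : a < b) (hUV : U ≤ V) {j : ℕ} (hj : j ≤ m) :
    ∃ A B : ℝ, 0 < A ∧ 0 < B ∧ ∀ x, p j x = A * q j x + B * q (j + 1) x := by
  have hpj := hp.1.2.2 j hj
  have hqj := hq.1.2.2 j (by omega)
  have hqj' := hq.1.2.2 (j + 1) (by omega)
  have hpV := hUV (hp.1.1 j hj)
  have hqV := hq.1.1 j (by omega)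
  have hqV' := hq.1.1 (j + 1) (by omega)
  have hpa := hp.iteratedDeriv_left_pos hab hj
  have hqa := hq.iteratedDeriv_left_pos hab (k := j) (by omega)
  have hpb := hp.iteratedDeriv_right_pos hab hj
  have hqb := hq.iteratedDeriv_right_pos hab (k := j + 1) (by omega)
  have hsub : m + 1 - (j + 1) = m - j := by omega
  rw [hsub] at hqb hqj'
  set A := iteratedDeriv j (p j) a / iteratedDeriv j (q j) a with hA
  set B := iteratedDeriv (m - j) (p j) b / iteratedDeriv (m - j) (q (j + 1)) b with hB
  have hBpos : 0 < B := by
    have := div_pos hpb hqb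
    rwa [mul_div_mul_left _ _ (pow_ne_zero _ (by norm_num))] at this
  refine ⟨A, B, div_pos hpa hqa, hBpos, fun x => ?_⟩
  have hder : ∀ l ≤ m + 1, ∀ x, iteratedDeriv l (p j - (A • q j + B • q (j + 1))) x =
      iteratedDeriv l (p j) x - (A * iteratedDeriv l (q j) x +
        B * iteratedDeriv l (q (j + 1)) x) := by
    intro l hl x
    have hs : ∀ u ∈ V, ContDiffAt ℝ l u x := fun u hu =>
      ((hV.2.1 u hu).of_le (by exact_mod_cast hl)).contDiffAt
    rw [iteratedDeriv_sub (hs _ hpV) (hs _ (V.add_mem (V.smul_mem A hqV) (V.smul_mem B hqV'))),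
      iteratedDeriv_add (hs _ (V.smul_mem A hqV)) (hs _ (V.smul_mem B hqV')),
      iteratedDeriv_const_smul (hs _ hqV), iteratedDeriv_const_smul (hs _ hqV'), smul_eq_mul,
      smul_eq_mul]
  have hzero := hV.eq_zero_of_endpoint_zeros hab
    (V.sub_mem hpV (V.add_mem (V.smul_mem A hqV) (V.smul_mem B hqV')))
    (i := j + 1) (j := m - j + 1) (by omega)
    (fun l hl => by
      rw [hder l (by omega), hqj'.1 l hl]
      rcases Nat.lt_succ_iff_lt_or_eq.1 hl with h' | rfl
      · simp [hpj.1 l h', hqj.1 l h']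
      · rw [hA, div_mul_cancel₀ _ hqj.2.1]; ring)
    (fun l hl => by
      rw [hder l (by omega), hqj.2.2.1 l (by omega)]
      rcases Nat.lt_succ_iff_lt_or_eq.1 hl with h' | rfl
      · simp [hpj.2.2.1 l h', hqj'.2.2.1 l h']
      · rw [hB, div_mul_cancel₀ _ hqj'.2.2.2]; ring)
  have := congrFun hzero x
  simp only [Pi.sub_apply, Pi.add_apply, Pi.smul_apply, smul_eq_mul, Pi.zero_apply] at this
  linarith

lemma eq_sum_of_dim_two (hp : IsNonnegBernsteinBasisOf 1 a b U p) (hU : IsExtChebyshev 1 a b U)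
    (hab : a < b) {g : ℝ → ℝ} (hg : g ∈ U) (x : ℝ) :
    g x = g a / p 0 a * p 0 x + g b / p 1 b * p 1 x := by
  have h0a : p 0 a ≠ 0 := by simpa using (hp.1.2.2 0 (by omega)).2.1
  have h0b : p 0 b = 0 := by simpa using (hp.1.2.2 0 (by omega)).2.2.1 0 (by omega)
  have h1a : p 1 a = 0 := by simpa using (hp.1.2.2 1 le_rfl).1 0 (by omega)
  have h1b : p 1 b ≠ 0 := by simpa using (hp.1.2.2 1 le_rfl).2.2.2
  have hzero := hU.eq_zero_of_endpoint_zeros hab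
    (U.sub_mem hg (U.add_mem (U.smul_mem (g a / p 0 a) (hp.1.1 0 (by omega)))
      (U.smul_mem (g b / p 1 b) (hp.1.1 1 le_rfl))))
    (i := 1) (j := 1) (by omega)
    (fun l hl => by
      obtain rfl : l = 0 := by omega
      simp [h1a, h0a])
    (fun l hl => by
      obtain rfl : l = 0 := by omega
      simp [h0b, h1b])
  have := congrFun hzero x
  simp only [Pi.sub_apply, Pi.add_apply, Pi.smul_apply, smul_eq_mul, Pi.zero_apply] at this
  linarith

end IsNonnegBernsteinBasisOf

/-- Bernstein coefficients after one degree elevation. -/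
def elevate (A B c : ℕ → ℝ) : ℕ → ℝ
  | 0 => A 0 * c 0
  | j + 1 => A (j + 1) * c (j + 1) + B j * c j

/-- Bernstein coefficients at level `k` obtained from those at level one; the value at level zero
is a placeholder. -/
def elevateIter (A B : ℕ → ℕ → ℝ) (c : ℕ → ℝ) : ℕ → ℕ → ℝ
  | 0 => c
  | 1 => c
  | k + 2 => elevate (A (k + 1)) (B (k + 1)) (elevateIter A B c (k + 1))

lemma elevateIter_succ (A B : ℕ → ℕ → ℝ) (c : ℕ → ℝ) {k : ℕ} (hk : 1 ≤ k) :
    elevateIter A B c (k + 1) = elevate (A k) (B k) (elevateIter A B c k) := by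
  obtain ⟨k, rfl⟩ := Nat.exists_eq_add_of_le' hk
  rfl

lemma elevate_eq_zero {A B c : ℕ → ℝ} {k : ℕ} (hc : ∀ j, k < j → c j = 0) {j : ℕ}
    (hj : k + 1 < j) : elevate A B c j = 0 := by
  obtain ⟨j, rfl⟩ := Nat.exists_eq_add_of_le' (Nat.one_le_of_lt hj)
  simp [elevate, hc (j + 1) (by omega), hc j (by omega)]

lemma elevate_pos {A B c : ℕ → ℝ} {k : ℕ} (hA : ∀ j ≤ k, 0 < A j) (hB : ∀ j ≤ k, 0 < B j)
    (hc : ∀ j ≤ k, 0 < c j) (hc0 : ∀ j, k < j → c j = 0) {j : ℕ}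
    (hj : j ≤ k + 1) : 0 < elevate A B c j := by
  rcases j with _ | j
  · exact mul_pos (hA 0 (by omega)) (hc 0 (by omega))
  · have h1 := mul_pos (hB j (by omega)) (hc j (by omega))
    simp only [elevate]
    rcases Nat.lt_or_ge k (j + 1) with h | h
    · rw [hc0 _ h]; linarith
    · linarith [mul_pos (hA _ h) (hc _ h)]

lemma sum_elevate {A B c q : ℕ → ℝ} {k : ℕ} (hc : ∀ j, k < j → c j = 0) :
    ∑ j ∈ range (k + 1 + 1), elevate A B c j * q j =
      ∑ j ∈ range (k + 1), c j * (A j * q j + B j * q (j + 1)) := by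
  have h1 : ∑ j ∈ range (k + 1), A (j + 1) * c (j + 1) * q (j + 1) + A 0 * c 0 * q 0 =
      ∑ j ∈ range (k + 1), A j * c j * q j := by
    rw [← sum_range_succ' (fun j => A j * c j * q j), sum_range_succ, hc (k + 1) (by omega)]
    ring
  have h2 : ∑ j ∈ range (k + 1), c j * (A j * q j + B j * q (j + 1)) =
      ∑ j ∈ range (k + 1), A j * c j * q j + ∑ j ∈ range (k + 1), B j * c j * q (j + 1) := by
    rw [← sum_add_distrib]
    exact sum_congr rfl fun j _ => by ring
  rw [h2, ← h1, sum_range_succ']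
  simp only [elevate, add_mul, sum_add_distrib]
  ring

section Ratios

variable {A B β γ : ℕ → ℝ} {k : ℕ}

lemma lt_mediant_and_mediant_lt {A B b₀ b₁ c₀ c₁ : ℝ} (hA : 0 < A) (hB : 0 < B) (hb₀ : 0 < b₀)
    (hb₁ : 0 < b₁) (h : c₀ / b₀ < c₁ / b₁) :
    c₀ / b₀ < (A * c₁ + B * c₀) / (A * b₁ + B * b₀) ∧
      (A * c₁ + B * c₀) / (A * b₁ + B * b₀) < c₁ / b₁ := by
  have hden : 0 < A * b₁ + B * b₀ := by positivity
  rw [div_lt_div_iff₀ hb₀ hb₁] at h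
  rw [div_lt_div_iff₀ hb₀ hden, div_lt_div_iff₀ hden hb₁]
  constructor
  · nlinarith [mul_lt_mul_of_pos_left h hA]
  · nlinarith [mul_lt_mul_of_pos_left h hB]

lemma elevate_ratio_interlace (hA : ∀ j ≤ k, 0 < A j) (hB : ∀ j ≤ k, 0 < B j)
    (hβ : ∀ j ≤ k, 0 < β j) (hr : ∀ j < k, γ j / β j < γ (j + 1) / β (j + 1)) {j : ℕ}
    (hj : j < k) :
    γ j / β j < elevate A B γ (j + 1) / elevate A B β (j + 1) ∧
      elevate A B γ (j + 1) / elevate A B β (j + 1) < γ (j + 1) / β (j + 1) :=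
  lt_mediant_and_mediant_lt (hA _ hj) (hB _ hj.le) (hβ _ hj.le) (hβ _ hj) (hr j hj)

lemma elevate_ratio_zero (hA : 0 < A 0) :
    elevate A B γ 0 / elevate A B β 0 = γ 0 / β 0 :=
  mul_div_mul_left _ _ hA.ne'

lemma elevate_ratio_last (hB : 0 < B k) (hβ0 : ∀ j, k < j → β j = 0) (hγ0 : ∀ j, k < j → γ j = 0) :
    elevate A B γ (k + 1) / elevate A B β (k + 1) = γ k / β k := by
  simp only [elevate, hβ0 (k + 1) (by omega), hγ0 (k + 1) (by omega), mul_zero, zero_add]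
  exact mul_div_mul_left _ _ hB.ne'

lemma elevate_ratio_strictMono (hk : 1 ≤ k) (hA : ∀ j ≤ k, 0 < A j) (hB : ∀ j ≤ k, 0 < B j)
    (hβ : ∀ j ≤ k, 0 < β j) (hβ0 : ∀ j, k < j → β j = 0) (hγ0 : ∀ j, k < j → γ j = 0)
    (hr : ∀ j < k, γ j / β j < γ (j + 1) / β (j + 1)) {j : ℕ} (hj : j < k + 1) :
    elevate A B γ j / elevate A B β j < elevate A B γ (j + 1) / elevate A B β (j + 1) := by
  rcases j with _ | j
  · rw [elevate_ratio_zero (hA 0 (by omega))]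
    exact (elevate_ratio_interlace hA hB hβ hr hk).1
  · refine (elevate_ratio_interlace hA hB hβ hr (by omega)).2.trans_le ?_
    rcases (Nat.lt_succ_iff.1 hj).eq_or_lt with rfl | h
    · exact (elevate_ratio_last (hB _ le_rfl) hβ0 hγ0).ge
    · exact (elevate_ratio_interlace hA hB hβ hr h).1.le

lemma elevate_ratio_mem_Icc {s : ℝ × ℝ} (hA : ∀ j ≤ k, 0 < A j) (hB : ∀ j ≤ k, 0 < B j)
    (hβ : ∀ j ≤ k, 0 < β j) (hβ0 : ∀ j, k < j → β j = 0) (hγ0 : ∀ j, k < j → γ j = 0)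
    (hr : ∀ j < k, γ j / β j < γ (j + 1) / β (j + 1))
    (hs : ∀ j ≤ k, γ j / β j ∈ Set.Icc s.1 s.2) {j : ℕ} (hj : j ≤ k + 1) :
    elevate A B γ j / elevate A B β j ∈ Set.Icc s.1 s.2 := by
  rcases j with _ | j
  · rw [elevate_ratio_zero (hA 0 (by omega))]
    exact hs 0 (by omega)
  · rcases (Nat.le_of_succ_le_succ hj).eq_or_lt with rfl | h
    · rw [elevate_ratio_last (hB _ le_rfl) hβ0 hγ0]
      exact hs _ le_rfl
    · have := elevate_ratio_interlace hA hB hβ hr h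
      exact ⟨(hs j h.le).1.trans this.1.le, this.2.le.trans (hs (j + 1) h).2⟩

end Ratios

/-- Bernstein coefficients, at level one, of a function with endpoint data `u` and `v`. -/
def levelOneCoeff (u v : ℝ) : ℕ → ℝ
  | 0 => u
  | 1 => v
  | _ + 2 => 0

lemma levelOneCoeff_eq_zero (u v : ℝ) {j : ℕ} (hj : 1 < j) : levelOneCoeff u v j = 0 := by
  obtain ⟨j, rfl⟩ := Nat.exists_eq_add_of_le' hj
  rfl

/-- A Haar pair contained in the second space of a chain of extended Chebyshev spaces admits
Bernstein operators with interlacing nodes. -/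
lemma exists_bernOp_chain {n : ℕ} {a b : ℝ} (hab : a < b) {U : ℕ → Submodule ℝ (ℝ → ℝ)}
    (hmono : Monotone U) (hcheb : ∀ k ≤ n, IsExtChebyshev k a b (U k)) {g0 g1 : ℝ → ℝ}
    (hg0 : g0 ∈ U 1) (hg1 : g1 ∈ U 1) (hH : IsHaarPair a b g0 g1) :
    ∃ (p : ℕ → ℕ → ℝ → ℝ) (t : ℕ → ℕ → ℝ) (α : ℕ → ℕ → ℝ),
      ∀ k, 1 ≤ k → k ≤ n →
        IsNonnegBernsteinBasisOf k a b (U k) (p k) ∧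
        (∀ j ≤ k, t k j ∈ Set.Icc a b) ∧
        (∀ j ≤ k, 0 < α k j) ∧
        FixesOn a b (bernOp k (p k) (t k) (α k)) g0 ∧
        FixesOn a b (bernOp k (p k) (t k) (α k)) g1 ∧
        (∀ j < k, t k j < t k (j + 1)) ∧
        (2 ≤ k → ∀ j, 1 ≤ j → j ≤ k - 1 →
          t (k - 1) (j - 1) < t k j ∧ t k j < t (k - 1) j) := by
  have hbasis : ∀ k ≤ n, ∃ p, IsNonnegBernsteinBasisOf k a b (U k) p := fun k hk =>
    (hcheb k hk).exists_nonnegBernsteinBasis hab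
  choose! p hp using hbasis
  have helev : ∀ k < n, ∀ j ≤ k, ∃ A B : ℝ, 0 < A ∧ 0 < B ∧
      ∀ x, p k j x = A * p (k + 1) j x + B * p (k + 1) (j + 1) x := fun k hk j hj =>
    (hp k hk.le).exists_elevation (hp (k + 1) hk) (hcheb (k + 1) hk) hab
      (hmono (Nat.le_succ k)) hj
  choose! A B hA hB hAB using helev
  set φ : ℝ → ℝ := fun x => g1 x / g0 x with hφ
  obtain ⟨hc0, hc1, hpos, hφmono⟩ := hH
  have ha : a ∈ Set.Icc a b := ⟨le_rfl, hab.le⟩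
  have hb : b ∈ Set.Icc a b := ⟨hab.le, le_rfl⟩
  set coeff : (ℝ → ℝ) → ℕ → ℕ → ℝ := fun g =>
    elevateIter A B (levelOneCoeff (g a / p 1 0 a) (g b / p 1 1 b)) with hcoeff
  have hcoeff_zero : ∀ g k, 1 ≤ k → ∀ j, k < j → coeff g k j = 0 := by
    intro g k hk
    induction k, hk using Nat.le_induction with
    | base => exact fun j hj => levelOneCoeff_eq_zero _ _ hj
    | succ k hk ih =>
      intro j hj
      simp only [hcoeff, elevateIter_succ _ _ _ hk]
      exact elevate_eq_zero ih hj
  have hrep : ∀ g ∈ U 1, ∀ k, 1 ≤ k → k ≤ n → ∀ x,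
      ∑ j ∈ range (k + 1), coeff g k j * p k j x = g x := by
    intro g hg k hk
    induction k, hk using Nat.le_induction with
    | base =>
      intro hn x
      rw [(hp 1 hn).eq_sum_of_dim_two (hcheb 1 hn) hab hg x, sum_range_succ, sum_range_one]
      rfl
    | succ k hk ih =>
      intro hn x
      simp only [hcoeff, elevateIter_succ _ _ _ hk]
      rw [sum_elevate (hcoeff_zero g k hk), ← ih (by omega) x]
      refine sum_congr rfl fun j hj => ?_
      rw [hAB k (by omega) j (by simpa [Nat.lt_succ_iff] using hj) x]
  have hinv : ∀ k, 1 ≤ k → k ≤ n → (∀ j ≤ k, 0 < coeff g0 k j) ∧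
      (∀ j < k, coeff g1 k j / coeff g0 k j < coeff g1 k (j + 1) / coeff g0 k (j + 1)) ∧
      ∀ j ≤ k, coeff g1 k j / coeff g0 k j ∈ Set.Icc (φ a) (φ b) := by
    intro k hk
    induction k, hk using Nat.le_induction with
    | base =>
      intro hn
      have h0 : 0 < p 1 0 a := by
        simpa using (hp 1 hn).iteratedDeriv_left_pos hab (k := 0) (by omega)
      have h1 : 0 < p 1 1 b := by
        simpa using (hp 1 hn).iteratedDeriv_right_pos hab (k := 1) (by omega)
      have r0 : coeff g1 1 0 / coeff g0 1 0 = φ a := div_div_div_cancel_right₀ h0.ne' _ _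
      have r1 : coeff g1 1 1 / coeff g0 1 1 = φ b := div_div_div_cancel_right₀ h1.ne' _ _
      have hlt := hφmono ha hb hab
      refine ⟨fun j hj => ?_, fun j hj => ?_, fun j hj => ?_⟩
      · interval_cases j
        · exact div_pos (hpos a ha) h0
        · exact div_pos (hpos b hb) h1
      · obtain rfl : j = 0 := by omega
        rw [r0, r1]
        exact hlt
      · interval_cases j
        · rw [r0]; exact ⟨le_rfl, hlt.le⟩
        · rw [r1]; exact ⟨hlt.le, le_rfl⟩
    | succ k hk ih =>
      intro hn
      obtain ⟨i1, i2, i3⟩ := ih (by omega)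
      simp only [hcoeff, elevateIter_succ _ _ _ hk]
      exact ⟨fun j hj => elevate_pos (hA k hn) (hB k hn) i1 (hcoeff_zero g0 k hk) hj,
        fun j hj => elevate_ratio_strictMono hk (hA k hn) (hB k hn) i1 (hcoeff_zero g0 k hk)
          (hcoeff_zero g1 k hk) i2 hj,
        fun j hj => elevate_ratio_mem_Icc (s := (φ a, φ b)) (hA k hn) (hB k hn) i1
          (hcoeff_zero g0 k hk) (hcoeff_zero g1 k hk) i2 i3 hj⟩
  have hφcont : ContinuousOn φ (Set.Icc a b) := hc1.div hc0 fun x hx => (hpos x hx).ne'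
  have hnode : ∀ k, 1 ≤ k → k ≤ n → ∀ j ≤ k,
      ∃ t ∈ Set.Icc a b, φ t = coeff g1 k j / coeff g0 k j := fun k hk hn j hj =>
    intermediate_value_Icc hab.le hφcont ((hinv k hk hn).2.2 j hj)
  choose! t ht hφt using hnode
  refine ⟨p, t, fun k j => coeff g0 k j / g0 (t k j), fun k hk hn => ?_⟩
  have htpos : ∀ j ≤ k, 0 < g0 (t k j) := fun j hj => hpos _ (ht k hk hn j hj)
  refine ⟨hp k hn, ht k hk hn, fun j hj => div_pos ((hinv k hk hn).1 j hj) (htpos j hj),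
    fun x _ => ?_, fun x _ => ?_, fun j hj => ?_, fun hk2 j hj1 hjk => ?_⟩
  · rw [bernOp, ← hrep g0 hg0 k hk hn x]
    refine sum_congr rfl fun j hj => ?_
    rw [mul_div_cancel₀ _ (htpos j (by simpa [Nat.lt_succ_iff] using hj)).ne']
  · rw [bernOp, ← hrep g1 hg1 k hk hn x]
    refine sum_congr rfl fun j hj => ?_
    have hj' : j ≤ k := by simpa [Nat.lt_succ_iff] using hj
    have h1 := hφt k hk hn j hj'
    have h2 := (htpos j hj').ne'
    have h3 := ((hinv k hk hn).1 j hj').ne'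
    simp only [hφ] at h1
    rw [div_eq_div_iff h2 h3] at h1
    rw [mul_div_assoc', h1, mul_div_cancel_right₀ _ h2]
  · rw [← hφmono.lt_iff_lt (ht k hk hn j hj.le) (ht k hk hn (j + 1) hj)]
    change φ _ < φ _
    rw [hφt k hk hn j hj.le, hφt k hk hn (j + 1) hj]
    exact (hinv k hk hn).2.1 j hj
  · obtain ⟨k, rfl⟩ := Nat.exists_eq_add_of_le' hk
    obtain ⟨j, rfl⟩ := Nat.exists_eq_add_of_le' hj1
    simp only [Nat.add_sub_cancel] at hjk ⊢
    have hk1 : 1 ≤ k := by omega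
    have hkn : k ≤ n := by omega
    obtain ⟨i1, i2, i3⟩ := hinv k hk1 hkn
    have key := elevate_ratio_interlace (hA k hn) (hB k hn) i1 i2 (j := j) (by omega)
    have hr := hφt (k + 1) hk hn (j + 1) (by omega)
    simp only [hcoeff, elevateIter_succ _ _ _ hk1] at hr
    rw [← hφmono.lt_iff_lt (ht k hk1 hkn j (by omega)) (ht (k + 1) hk hn (j + 1) (by omega)),
      ← hφmono.lt_iff_lt (ht (k + 1) hk hn (j + 1) (by omega)) (ht k hk1 hkn (j + 1) (by omega))]
    change φ _ < φ _ ∧ φ _ < φ _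
    rw [hφt k hk1 hkn j (by omega), hφt k hk1 hkn (j + 1) (by omega), hr]
    exact key

/-- Two functions spanning a chain of extended Chebyshev spaces form a Haar pair up to signs. -/
lemma exists_signs_isHaarPair {a b : ℝ} (hab : a ≤ b) {U V : Submodule ℝ (ℝ → ℝ)}
    (hU : IsExtChebyshev 0 a b U) (hV : IsExtChebyshev 1 a b V) {f0 f1 : ℝ → ℝ}
    (h0 : f0 ∈ U) (h00 : f0 ≠ 0) (h0V : f0 ∈ V) (h1 : f1 ∈ V) (h01 : ∀ c : ℝ, f1 - c • f0 ≠ 0) :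
    ∃ ε0 ε1 : ℝ, (ε0 = 1 ∨ ε0 = -1) ∧ (ε1 = 1 ∨ ε1 = -1) ∧
      IsHaarPair a b (fun x => ε0 * f0 x) (fun x => ε1 * f1 x) := by
  have hne : ∀ x ∈ Set.Icc a b, f0 x ≠ 0 := by
    intro x hx hfx
    have := hU.2.2 f0 h0 h00 {x} (fun _ => 1) (by simpa using hx)
      (by intro y hy i hi
          obtain rfl := mem_singleton.1 hy
          obtain rfl : i = 0 := by omega
          simpa using hfx)
    simp at this
  have hcont0 : Continuous f0 := (hV.2.1 f0 h0V).continuous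
  have hcont1 : Continuous f1 := (hV.2.1 f1 h1).continuous
  obtain ⟨ε0, hε0, hpos⟩ : ∃ ε0 : ℝ, (ε0 = 1 ∨ ε0 = -1) ∧ ∀ x ∈ Set.Icc a b, 0 < ε0 * f0 x := by
    rcases nonneg_or_nonpos_of_ne_zero hcont0
      (fun z hz => hne z (Set.Ioo_subset_Icc_self hz)) with h | h
    · exact ⟨1, Or.inl rfl, fun x hx => by
        rw [one_mul]; exact lt_of_le_of_ne (h x hx) (hne x hx).symm⟩
    · exact ⟨-1, Or.inr rfl, fun x hx => by
        linarith [lt_of_le_of_ne (h x hx) (hne x hx)]⟩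
  have hε00 : ε0 ≠ 0 := by rcases hε0 with rfl | rfl <;> norm_num
  have hinj : Set.InjOn (fun x => f1 x / (ε0 * f0 x)) (Set.Icc a b) := by
    intro x hx y hy hxy
    by_contra hxy'
    set c := f1 x / f0 x with hc
    have hy' : f1 y = c * f0 y := by
      simp only [div_mul_eq_div_div_swap] at hxy
      rw [hc, (div_left_inj' hε00).1 hxy, div_mul_cancel₀ _ (hne y hy)]
    have hx' : f1 x = c * f0 x := by rw [hc, div_mul_cancel₀ _ (hne x hx)]
    have := hV.2.2 _ (V.sub_mem h1 (V.smul_mem c h0V)) (h01 c) {x, y} (fun _ => 1)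
      (by simp only [mem_insert, mem_singleton]
          rintro z (rfl | rfl) <;> assumption)
      (by simp only [mem_insert, mem_singleton]
          rintro z (rfl | rfl) i hi <;> obtain rfl : i = 0 := by omega
          · simp [hx']
          · simp [hy'])
    rw [sum_pair hxy'] at this
    omega
  have hcq : ContinuousOn (fun x => f1 x / (ε0 * f0 x)) (Set.Icc a b) :=
    hcont1.continuousOn.div (by fun_prop)
      fun x hx => (hpos x hx).ne'
  rcases hcq.strictMonoOn_of_injOn_Icc' hab hinj with h | h
  · exact ⟨ε0, 1, hε0, Or.inl rfl, (by fun_prop), (by fun_prop), hpos, by simpa using h⟩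
  · refine ⟨ε0, -1, hε0, Or.inr rfl, (by fun_prop), (by fun_prop), hpos, fun x hx y hy hxy => ?_⟩
    have := h hx hy hxy
    simp only [neg_one_mul, neg_div] at this ⊢
    linarith

/-- chain of extended Chebyshev spaces yields Bernstein operators
with strictly increasing and (across levels) strictly interlacing nodes. -/
theorem bernstein_operator_chain
    (n : ℕ) (hn : 1 ≤ n) (a b : ℝ) (hab : a < b)
    (f : ℕ → ℝ → ℝ)
    (hsm : ∀ k ≤ n, ContDiff ℝ n (f k))
    (hcheb : ∀ k ≤ n, IsExtChebyshev k a b (Submodule.span ℝ (f '' Set.Iic k))) :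
    ∃ ε0 ε1 : ℝ, (ε0 = 1 ∨ ε0 = -1) ∧ (ε1 = 1 ∨ ε1 = -1) ∧
      IsHaarPair a b (fun x => ε0 * f 0 x) (fun x => ε1 * f 1 x) ∧
      ∃ (p : ℕ → ℕ → ℝ → ℝ) (t : ℕ → ℕ → ℝ) (α : ℕ → ℕ → ℝ),
        ∀ k, 1 ≤ k → k ≤ n →
          IsNonnegBernsteinBasisOf k a b (Submodule.span ℝ (f '' Set.Iic k)) (p k) ∧
          (∀ j ≤ k, t k j ∈ Set.Icc a b) ∧
          (∀ j ≤ k, 0 < α k j) ∧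
          FixesOn a b (bernOp k (p k) (t k) (α k)) (fun x => ε0 * f 0 x) ∧
          FixesOn a b (bernOp k (p k) (t k) (α k)) (fun x => ε1 * f 1 x) ∧
          (∀ j < k, t k j < t k (j + 1)) ∧
          (2 ≤ k → ∀ j, 1 ≤ j → j ≤ k - 1 →
            t (k - 1) (j - 1) < t k j ∧ t k j < t (k - 1) j) := by
  have hmono : Monotone fun k => Submodule.span ℝ (f '' Set.Iic k) := fun k l hkl =>
    Submodule.span_mono (Set.image_mono (Set.Iic_subset_Iic.2 hkl))
  have hmem : ∀ i k, i ≤ k → f i ∈ Submodule.span ℝ (f '' Set.Iic k) := fun i k hik =>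
    Submodule.subset_span ⟨i, hik, rfl⟩
  have hspan0 : Submodule.span ℝ (f '' Set.Iic 0) = Submodule.span ℝ {f 0} := by
    congr 1
    ext g
    simp [eq_comm]
  have h00 : f 0 ≠ 0 := by
    intro h
    have := (hcheb 0 (by omega)).1
    rw [hspan0, h, Submodule.span_zero_singleton, finrank_bot] at this
    omega
  have h01 : ∀ c : ℝ, f 1 - c • f 0 ≠ 0 := by
    intro c h
    have hle : Submodule.span ℝ (f '' Set.Iic 1) ≤ Submodule.span ℝ (f '' Set.Iic 0) := by
      rw [Submodule.span_le]
      rintro _ ⟨i, hi, rfl⟩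
      rcases Nat.le_one_iff_eq_zero_or_eq_one.1 hi with rfl | rfl
      · exact hmem 0 0 le_rfl
      · rw [sub_eq_zero.1 h]
        exact Submodule.smul_mem _ c (hmem 0 0 le_rfl)
    have heq := le_antisymm hle (hmono (Nat.zero_le 1))
    have h1 := (hcheb 1 hn).1
    rw [heq, (hcheb 0 (by omega)).1] at h1
    omega
  obtain ⟨ε0, ε1, hε0, hε1, hH⟩ := exists_signs_isHaarPair hab.le (hcheb 0 (by omega)) (hcheb 1 hn)
    (hmem 0 0 le_rfl) h00 (hmem 0 1 (by omega)) (hmem 1 1 le_rfl) h01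
  exact ⟨ε0, ε1, hε0, hε1, hH, exists_bernOp_chain hab hmono hcheb
    (Submodule.smul_mem _ ε0 (hmem 0 1 (by omega))) (Submodule.smul_mem _ ε1 (hmem 1 1 le_rfl)) hH⟩
end

section
/- Let (f_0, f_1) be a Haar pair on [a,b], let s_k < s_{k+1} < s_{k+2} be points of [a,b], and let G_k : C[a,b] → ℝ be the functional G_k(f) = a_k f(s_k) + b_k f(s_{k+1}) + c_k f(s_{k+2}) for fixed reals a_k, b_k, c_k, and suppose G_k(f_0) = G_k(f_1) = 0. Then b_k ≥ 0 if and only if G_k(f) ≤ 0 for every continuous (f_0,f_1)-convex function f on [a,b]. -/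
open Finset

theorem IsHaarPair.minor_pos {a b : ℝ} {f0 f1 : ℝ → ℝ} (h : IsHaarPair a b f0 f1) {x y : ℝ}
    (hx : x ∈ Set.Icc a b) (hy : y ∈ Set.Icc a b) (hxy : x < y) :
    0 < f0 x * f1 y - f0 y * f1 x := by
  have hlt := h.2.2.2 hx hy hxy
  simp only at hlt
  rw [div_lt_div_iff₀ (h.2.2.1 x hx) (h.2.2.1 y hy)] at hlt
  linarith

theorem IsHaarPair.continuousOn_sq_div {a b : ℝ} {f0 f1 : ℝ → ℝ} (h : IsHaarPair a b f0 f1) :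
    ContinuousOn (fun x => f1 x ^ 2 / f0 x) (Set.Icc a b) :=
  (h.2.1.pow 2).div h.1 fun x hx => (h.2.2.1 x hx).ne'

theorem IsHaarPair.det_sq_div_pos {a b : ℝ} {f0 f1 : ℝ → ℝ} (h : IsHaarPair a b f0 f1)
    {x y z : ℝ} (hx : x ∈ Set.Icc a b) (hy : y ∈ Set.Icc a b) (hz : z ∈ Set.Icc a b)
    (hxy : x < y) (hyz : y < z) :
    0 < Matrix.det !![f0 x, f0 y, f0 z; f1 x, f1 y, f1 z;
      f1 x ^ 2 / f0 x, f1 y ^ 2 / f0 y, f1 z ^ 2 / f0 z] := by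
  have px := h.2.2.1 x hx
  have py := h.2.2.1 y hy
  have pz := h.2.2.1 z hz
  have mxy := h.minor_pos hx hy hxy
  have myz := h.minor_pos hy hz hyz
  have mxz := h.minor_pos hx hz (hxy.trans hyz)
  have key : Matrix.det !![f0 x, f0 y, f0 z; f1 x, f1 y, f1 z;
      f1 x ^ 2 / f0 x, f1 y ^ 2 / f0 y, f1 z ^ 2 / f0 z] =
      (f0 x * f1 y - f0 y * f1 x) * (f0 y * f1 z - f0 z * f1 y) *
        (f0 x * f1 z - f0 z * f1 x) / (f0 x * f0 y * f0 z) := by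
    simp [Matrix.det_fin_three]
    field_simp
    ring
  rw [key]
  positivity

/-- a three-point functional annihilating a Haar pair is non-positive
on all continuous (f0,f1)-convex functions iff its middle coefficient is ≥ 0. -/
theorem middle_coefficient_nonneg_iff
    (a b : ℝ) (hab : a < b) (f0 f1 : ℝ → ℝ)
    (hHaar : IsHaarPair a b f0 f1)
    (s0 s1 s2 : ℝ)
    (hs0 : s0 ∈ Set.Icc a b) (hs1 : s1 ∈ Set.Icc a b) (hs2 : s2 ∈ Set.Icc a b)
    (h01 : s0 < s1) (h12 : s1 < s2)
    (ak bk ck : ℝ)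
    (hG0 : ak * f0 s0 + bk * f0 s1 + ck * f0 s2 = 0)
    (hG1 : ak * f1 s0 + bk * f1 s1 + ck * f1 s2 = 0) :
    0 ≤ bk ↔
      ∀ f : ℝ → ℝ, ContinuousOn f (Set.Icc a b) → ConvexWrt a b f0 f1 f →
        ak * f s0 + bk * f s1 + ck * f s2 ≤ 0 := by
  have m02 := hHaar.minor_pos hs0 hs2 (h01.trans h12)
  have key : ∀ f : ℝ → ℝ, (f0 s0 * f1 s2 - f0 s2 * f1 s0) *
      (ak * f s0 + bk * f s1 + ck * f s2) =
      -bk * Matrix.det !![f0 s0, f0 s1, f0 s2; f1 s0, f1 s1, f1 s2; f s0, f s1, f s2] := by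
    intro f
    simp [Matrix.det_fin_three]
    linear_combination (f s0 * f1 s2 - f s2 * f1 s0) * hG0 -
      (f s0 * f0 s2 - f s2 * f0 s0) * hG1
  constructor
  · intro hb f _ hf
    have hD := hf s0 hs0 s1 hs1 s2 hs2 h01 h12
    refine nonpos_of_mul_nonpos_right ?_ m02
    rw [key f]
    exact mul_nonpos_of_nonpos_of_nonneg (neg_nonpos.mpr hb) hD
  · intro h
    by_contra! hb
    have hG := h _ hHaar.continuousOn_sq_div
      fun x hx y hy z hz hxy hyz => (hHaar.det_sq_div_pos hx hy hz hxy hyz).le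
    have hD := hHaar.det_sq_div_pos hs0 hs1 hs2 h01 h12
    have hpos := mul_pos (neg_pos.mpr hb) hD
    rw [← key fun x => f1 x ^ 2 / f0 x] at hpos
    exact hpos.not_ge (mul_nonpos_of_nonneg_of_nonpos m02.le hG)
end
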